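/- Let $N \geq 2$, $1 \leq d < N$, $0 < p < q \leq \infty$, $s > \sigma_p := N(1/p-1)_+$, and assume $sp < d$. Set $r = dp/(d - sp)$. Then there exists $f \in B^s_{p,q}(\mathbb{R}^N)$ such that $f(\cdot, y) \notin L^{r,\infty}(\mathbb{R}^d)$ for almost every $y \in \mathbb{R}^{N-d}$. -/

import Mathlib

open MeasureTheory
open scoped ENNReal

noncomputable section

/-- The `M`-th iterated difference operator `Δ_h^M f`. -/
def iterDiff {E : Type*} [AddCommGroup E] [Module ℝ E] (M : ℕ) (f : E → ℝ) (h : E) :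
    E → ℝ :=
  fun x => ∑ i ∈ Finset.range (M + 1), (-1 : ℝ) ^ (M - i) * (M.choose i) * f (x + (i : ℝ) • h)

/-- `σ_p = N (1/p - 1)_+`. -/
def sigmaP (n : ℕ) (p : ℝ≥0∞) : ℝ := n * max (1 / p.toReal - 1) 0

/-- The Besov quasi-norm on `ℝ^n`, defined via `M = ⌊s⌋ + 1` iterated differences:
`‖f‖_{L^p} + (∫_{|h|≤1} ‖Δ_h^M f‖_{L^p}^q |h|^{-n-sq} dh)^{1/q}`
(usual modification if `q = ∞`). -/
def besovNorm (n : ℕ) (p q : ℝ≥0∞) (s : ℝ) (f : (Fin n → ℝ) → ℝ) : ℝ≥0∞ :=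
  eLpNorm f p volume +
    (if q = ⊤ then
      ⨆ (h : Fin n → ℝ) (_ : ‖h‖ ≤ 1),
        eLpNorm (iterDiff (⌊s⌋₊ + 1) f h) p volume * ENNReal.ofReal (‖h‖ ^ (-s))
    else
      (∫⁻ h in {h : Fin n → ℝ | ‖h‖ ≤ 1},
          eLpNorm (iterDiff (⌊s⌋₊ + 1) f h) p volume ^ q.toReal *
            ENNReal.ofReal (‖h‖ ^ (-(n : ℝ) - s * q.toReal))) ^ (1 / q.toReal))

/-- Membership in the Besov space `B^s_{p,q}(ℝ^n)`. -/
def MemBesov (n : ℕ) (p q : ℝ≥0∞) (s : ℝ) (f : (Fin n → ℝ) → ℝ) : Prop :=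
  AEStronglyMeasurable f volume ∧ besovNorm n p q s f < ⊤

/-- The restriction `f(·, y)` of `f : ℝ^N → ℝ` to the `d`-plane with last `N - d`
coordinates equal to `y`. -/
def restrictLast (N d : ℕ) (f : (Fin N → ℝ) → ℝ) (y : Fin (N - d) → ℝ) :
    (Fin d → ℝ) → ℝ :=
  fun x => f fun i =>
    if h : (i : ℕ) < d then x ⟨i, h⟩ else y ⟨(i : ℕ) - d, by have := i.isLt; omega⟩

end

/-- Membership in the weak Lebesgue space `L^{r,∞}(ℝ^d)`:
`sup_{t>0} t μ({|g| > t})^{1/r} < ∞` (equivalently `sup_{t>0} t^{1/r} g^*(t) < ∞` in terms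
of the decreasing rearrangement). -/
def MemWeakLp {n : ℕ} (r : ℝ) (g : (Fin n → ℝ) → ℝ) : Prop :=
  MeasureTheory.AEStronglyMeasurable g volume ∧
    ∃ C : ℝ, ∀ t : ℝ, 0 < t →
      ENNReal.ofReal t * (volume {x | t < |g x|}) ^ (1 / r) ≤ ENNReal.ofReal C


open Filter Topology

namespace BesovAux

/-- One-dimensional bound on iterated unit differences. -/
lemma fwd_bound (M : ℕ) : ∀ (g : ℝ → ℝ) (C : ℝ), ContDiff ℝ (⊤ : ℕ∞) g →
    (∀ t, |iteratedDeriv M g t| ≤ C) → ∀ t, |(fwdDiff (1 : ℝ))^[M] g t| ≤ C := by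
  induction M with
  | zero => intro g C _ h t; simpa using h t
  | succ M ih =>
    intro g C hg h t
    rw [Function.iterate_succ_apply]
    have hsh : ContDiff ℝ (⊤ : ℕ∞) (fun z : ℝ => g (z + 1)) := hg.comp (contDiff_id.add contDiff_const)
    have e : fwdDiff (1 : ℝ) g = fun z => g (z + 1) - g z := rfl
    refine ih _ C (by rw [e]; exact hsh.sub hg) ?_ t
    intro t
    rw [e, iteratedDeriv_fun_sub (hsh.contDiffAt.of_le (by exact_mod_cast le_top))
      (hg.contDiffAt.of_le (by exact_mod_cast le_top)), iteratedDeriv_comp_add_const]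
    have hd : Differentiable ℝ (iteratedDeriv M g) :=
      hg.differentiable_iteratedDeriv M (by exact_mod_cast WithTop.coe_lt_top M)
    have := Convex.norm_image_sub_le_of_norm_deriv_le (f := iteratedDeriv M g) (s := Set.univ)
      (x := t) (y := t + 1) (C := C) (fun x _ => hd x)
      (fun x _ => by rw [← iteratedDeriv_succ]; exact h x) convex_univ trivial trivial
    simpa using this

lemma iterDiff_eq {E : Type*} [AddCommGroup E] [Module ℝ E] (M : ℕ) (f : E → ℝ) (h x : E) :
    iterDiff M f h x = (fwdDiff (1 : ℝ))^[M] (fun t : ℝ => f (x + t • h)) 0 := by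
  rw [fwdDiff_iter_eq_sum_shift]
  simp [iterDiff]

lemma iterDiff_smooth_bound {E : Type*} [NormedAddCommGroup E] [NormedSpace ℝ E] (M : ℕ)
    (f : E → ℝ) (hf : ContDiff ℝ (⊤ : ℕ∞) f) (C : ℝ)
    (hC : ∀ x, ‖iteratedFDeriv ℝ M f x‖ ≤ C) (h x : E) :
    |iterDiff M f h x| ≤ C * ‖h‖ ^ M := by
  rw [iterDiff_eq]
  apply fwd_bound
  · fun_prop
  intro t
  rw [← Real.norm_eq_abs, ← norm_iteratedFDeriv_eq_norm_iteratedDeriv]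
  have hsh : ContDiff ℝ (⊤ : ℕ∞) (fun z : E => f (x + z)) := by fun_prop
  have := ContinuousLinearMap.iteratedFDeriv_comp_right
    ((ContinuousLinearMap.id ℝ ℝ).smulRight h) hsh t (i := M) (by exact_mod_cast le_top)
  have e : ((fun z : E => f (x + z)) ∘ ⇑((ContinuousLinearMap.id ℝ ℝ).smulRight h))
      = fun t : ℝ => f (x + t • h) := by ext; simp
  rw [e] at this
  rw [this]
  refine (ContinuousMultilinearMap.norm_compContinuousLinearMap_le _ _).trans ?_
  rw [iteratedFDeriv_comp_add_left]
  have hn : ‖(ContinuousLinearMap.id ℝ ℝ).smulRight h‖ ≤ ‖h‖ := by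
    rw [ContinuousLinearMap.norm_smulRight_apply]
    simp
  have hp : ∏ _i : Fin M, ‖(ContinuousLinearMap.id ℝ ℝ).smulRight h‖ ≤ ‖h‖ ^ M := by
    simp only [Finset.prod_const, Finset.card_univ, Fintype.card_fin]
    gcongr
  exact mul_le_mul (hC _) hp (by positivity) ((norm_nonneg _).trans (hC x))

lemma iterDiff_bdd {E : Type*} [AddCommGroup E] [Module ℝ E] (M : ℕ)
    (f : E → ℝ) (hf : ∀ x, |f x| ≤ 1) (h x : E) :
    |iterDiff M f h x| ≤ 2 ^ M := by
  unfold iterDiff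
  refine (Finset.abs_sum_le_sum_abs _ _).trans ?_
  have : ((2 : ℝ)) ^ M = ∑ i ∈ Finset.range (M + 1), (M.choose i : ℝ) := by
    exact_mod_cast (Nat.sum_range_choose M).symm
  rw [this]
  refine Finset.sum_le_sum fun i _ => ?_
  rw [abs_mul, abs_mul, abs_pow]
  simp only [abs_neg, abs_one, one_pow, one_mul, Nat.abs_cast]
  exact mul_le_of_le_one_right (by positivity) (hf _)

/-- The basic bump function. -/
lemma exists_bump (N M : ℕ) : ∃ (Φ : (Fin N → ℝ) → ℝ) (C : ℝ), 0 < C ∧ Continuous Φ ∧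
    (∀ z, 0 ≤ Φ z) ∧ (∀ z, ‖z‖ ≤ 1 → Φ z = 1) ∧ (∀ z, 2 ≤ ‖z‖ → Φ z = 0) ∧ (∀ z, |Φ z| ≤ C) ∧
    ∀ h z, |iterDiff M Φ h z| ≤ C * min 1 (‖h‖ ^ M) := by
  let B : ContDiffBump (0 : Fin N → ℝ) := ⟨1, 2, one_pos, one_lt_two⟩
  have hsm : ContDiff ℝ (⊤ : ℕ∞) B := B.contDiff
  have hcs : HasCompactSupport (iteratedFDeriv ℝ M B) := B.hasCompactSupport.iteratedFDeriv M
  obtain ⟨C, hC⟩ := hcs.exists_bound_of_continuous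
    (hsm.continuous_iteratedFDeriv (by exact_mod_cast le_top))
  have hb : ∀ z, |B z| ≤ 1 := fun z => by rw [abs_of_nonneg B.nonneg]; exact B.le_one
  refine ⟨B, max C (2 ^ M), lt_max_of_lt_right (by positivity), B.continuous, fun z => B.nonneg,
    fun z hz => B.one_of_mem_closedBall (by simpa using hz),
    fun z hz => B.zero_of_le_dist (by simpa using hz),
    fun z => (hb z).trans (le_max_of_le_right (one_le_pow₀ one_le_two)), fun h z => ?_⟩
  rw [mul_min_of_nonneg _ _ (by positivity)]
  refine le_min ?_ ?_
  · rw [mul_one]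
    exact (iterDiff_bdd M B hb h z).trans (le_max_right _ _)
  · refine (iterDiff_smooth_bound M B hsm C hC h z).trans ?_
    gcongr
    exact le_max_left _ _

lemma tsum_weight (ρ : ℝ≥0∞) (e : ℕ) :
    ∑' j : ℕ, ρ ^ ((e - j) + (j - e)) ≤ 2 * ∑' i : ℕ, ρ ^ i := by
  rw [← Summable.sum_add_tsum_nat_add' (f := fun j : ℕ => ρ ^ ((e - j) + (j - e))) (k := e)
    ENNReal.summable]
  rw [two_mul]
  refine add_le_add ?_ ?_
  · rw [← Finset.sum_range_reflect]
    calc _ ≤ ∑ j ∈ Finset.range e, ρ ^ (j + 1) := by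
            refine Finset.sum_le_sum fun j hj => le_of_eq ?_
            congr 1
            have := Finset.mem_range.1 hj
            omega
      _ ≤ ∑' j, ρ ^ (j + 1) := ENNReal.sum_le_tsum _
      _ ≤ ∑' j, ρ ^ j := by
        exact ENNReal.tsum_comp_le_tsum_of_injective (add_left_injective 1) (fun j => ρ ^ j)
  · refine ENNReal.tsum_le_tsum fun j => le_of_eq ?_
    congr 1
    omega

lemma holder_tsum {K : Type*} (w β : K → ℝ≥0∞) (a : ℝ) (ha : 1 ≤ a) :
    (∑' k, w k * β k) ^ a ≤ (∑' k, w k) ^ (a - 1) * ∑' k, w k * β k ^ a := by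
  have ha0 : 0 < a := by linarith
  have h1 : ∑' k, w k * β k ≤ (∑' k, w k) ^ (1 - a⁻¹) * (∑' k, w k * β k ^ a) ^ a⁻¹ := by
    rw [ENNReal.tsum_eq_iSup_sum]
    refine iSup_le fun t => (ENNReal.inner_le_weight_mul_Lp_of_nonneg t ha w β).trans ?_
    have : 0 ≤ 1 - a⁻¹ := by
      have := inv_le_one_of_one_le₀ ha
      linarith
    gcongr <;> exact ENNReal.sum_le_tsum _
  calc _ ≤ ((∑' k, w k) ^ (1 - a⁻¹) * (∑' k, w k * β k ^ a) ^ a⁻¹) ^ a := by gcongr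
    _ = _ := by
      rw [ENNReal.mul_rpow_of_nonneg _ _ ha0.le, ← ENNReal.rpow_mul, ← ENNReal.rpow_mul]
      congr 2
      · field_simp
      · rw [inv_mul_cancel₀ ha0.ne', ENNReal.rpow_one]

lemma exists_cover (n : ℕ) (hn : 1 ≤ n) (P a : ℝ) (ha : 1 < a) :
    ∃ (K : Type) (_ : Countable K) (c : K → ℝ) (L : K → ℕ) (y : K → Fin n → ℝ),
      (∀ k, 0 < c k) ∧ (∀ k, 0 < L k) ∧
      (∑' k, (ENNReal.ofReal (c k ^ P * (1 / (L k : ℝ)) ^ n)) ^ a < ⊤) ∧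
      ∀ (v : Fin n → ℝ) (C : ℝ), ∃ k, C < c k ∧ ‖v - y k‖ ≤ 1 / (L k : ℝ) := by
  have hL : ∀ m : ℕ, ∃ L : ℕ, 0 < L ∧
      ((2 * (m + 1) * L : ℕ) ^ n : ℝ) * (((m : ℝ) + 1) ^ P * (1 / (L : ℝ)) ^ n) ^ a
        ≤ (1 / 2 : ℝ) ^ m := by
    intro m
    have ht : Tendsto (fun L : ℕ => ((2 * ((m : ℝ) + 1)) ^ n * (((m : ℝ) + 1) ^ P) ^ a) *
        (L : ℝ) ^ (-(n * (a - 1)))) atTop (𝓝 (((2 * ((m : ℝ) + 1)) ^ n * (((m : ℝ) + 1) ^ P) ^ a) * 0)) := by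
      refine Tendsto.const_mul _ ?_
      refine (tendsto_rpow_neg_atTop ?_).comp tendsto_natCast_atTop_atTop
      have : (1 : ℝ) ≤ n := by exact_mod_cast hn
      have : 0 < a - 1 := by linarith
      positivity
    rw [mul_zero] at ht
    have h1 := ht.eventually_le_const (show (0 : ℝ) < (1 / 2 : ℝ) ^ m by positivity)
    obtain ⟨L, h2, h3⟩ := (h1.and (eventually_gt_atTop 0)).exists
    refine ⟨L, h3, le_trans (le_of_eq ?_) h2⟩
    have hLpos : (0 : ℝ) < L := by exact_mod_cast h3
    rw [Real.mul_rpow (by positivity) (by positivity)]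
    push_cast
    rw [mul_pow _ (L : ℝ) n]
    have : (L : ℝ) ^ (-(n * (a - 1))) = (L : ℝ) ^ n * (((1 / (L : ℝ)) ^ n) ^ a) := by
      rw [one_div, ← Real.rpow_natCast, ← Real.rpow_natCast, ← Real.rpow_mul (by positivity),
        Real.inv_rpow hLpos.le, ← Real.rpow_neg hLpos.le, ← Real.rpow_add hLpos]
      congr 1
      ring
    rw [this]
    ring
  choose L hL0 hL using hL
  refine ⟨Σ m : ℕ, (Fin n → Fin (2 * (m + 1) * L m)), inferInstance, fun k => (k.1 : ℝ) + 1,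
    fun k => L k.1, fun k i => ((k.2 i : ℕ) : ℝ) / L k.1 - ((k.1 : ℝ) + 1), fun k => by positivity,
    fun k => hL0 _, ?_, ?_⟩
  · rw [ENNReal.tsum_sigma' ]
    refine lt_of_le_of_lt (ENNReal.tsum_le_tsum (g := fun m : ℕ => (2⁻¹ : ℝ≥0∞) ^ m) fun m => ?_) ?_
    · rw [tsum_fintype]
      simp only [Finset.sum_const, Finset.card_univ, Fintype.card_fun, Fintype.card_fin, nsmul_eq_mul]
      rw [ENNReal.ofReal_rpow_of_nonneg (by positivity) (by linarith), ← ENNReal.ofReal_natCast,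
        ← ENNReal.ofReal_mul (by positivity)]
      refine (ENNReal.ofReal_le_ofReal (q := (1 / 2 : ℝ) ^ m) ?_).trans ?_
      · refine le_trans (le_of_eq ?_) (hL m)
        push_cast
        rfl
      · rw [ENNReal.ofReal_pow (by norm_num), one_div, ENNReal.ofReal_inv_of_pos (by norm_num)]
        simp
    · rw [ENNReal.tsum_geometric]
      simp
  · intro v C
    obtain ⟨m, hm⟩ := exists_nat_ge (max C ‖v‖)
    have hmC := (le_max_left _ _).trans hm
    have hmv := (le_max_right _ _).trans hm
    have hLp : (0 : ℝ) < L m := by exact_mod_cast hL0 m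
    have hv : ∀ i, |v i| ≤ m := fun i => (norm_le_pi_norm v i).trans hmv
    have hnn : ∀ i, 0 ≤ (v i + (m + 1)) * L m := fun i => by
      have := (abs_le.1 (hv i)).1
      exact mul_nonneg (by linarith) hLp.le
    have hlt : ∀ i, ⌊(v i + (m + 1)) * L m⌋₊ < 2 * (m + 1) * L m := fun i => by
      rw [Nat.floor_lt (hnn i)]
      push_cast
      have := (abs_le.1 (hv i)).2
      exact mul_lt_mul_of_pos_right (by linarith) hLp
    refine ⟨⟨m, fun i => ⟨_, hlt i⟩⟩, by simp only; linarith, ?_⟩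
    rw [pi_norm_le_iff_of_nonneg (by positivity)]
    intro i
    simp only [Pi.sub_apply, Real.norm_eq_abs]
    have h1 := Nat.floor_le (hnn i)
    have h2 := Nat.lt_floor_add_one ((v i + (m + 1)) * L m)
    set F : ℝ := (⌊(v i + (m + 1)) * L m⌋₊ : ℝ)
    have h3 : v i - (F / L m - (m + 1)) = ((v i + (m + 1)) * L m - F) / L m := by
      field_simp
      ring
    rw [h3, abs_of_nonneg (div_nonneg (by linarith) hLp.le)]
    gcongr
    linarith


lemma memBesov_of_pieces (N : ℕ) (hN : 1 ≤ N) (p q : ℝ≥0∞) (hp : 0 < p) (hpq : p < q)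
    (s : ℝ) (hs : 0 < s) (a : ℝ) (ha : 1 < a) (haq : q ≠ ⊤ → q.toReal = a * p.toReal)
    {K : Type} [Countable K] (F : K → (Fin N → ℝ) → ℝ) (hFc : ∀ k, Measurable (F k))
    (f : (Fin N → ℝ) → ℝ) (hf : Measurable f)
    (hsel : ∀ z h : Fin N → ℝ, ‖h‖ ≤ 1 → ∃ k, ∀ i : ℕ, i ≤ ⌊s⌋₊ + 1 →
      f (z + (i : ℝ) • h) = F k (z + (i : ℝ) • h))
    (e : K → ℕ) (he : Function.Injective e) (β : K → ℝ≥0∞) (hβ : ∑' k, β k ^ a < ⊤)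
    (C₀ ρ : ℝ≥0∞) (hC : C₀ < ⊤) (hρ : ρ < 1)
    (h0 : ∀ k, ∫⁻ z, ‖F k z‖ₑ ^ p.toReal ≤ C₀ * (ρ ^ (e k) * β k))
    (h1 : ∀ k (j : ℕ) (h : Fin N → ℝ), (1 / 2 : ℝ) ^ (j + 1) < ‖h‖ → ‖h‖ ≤ (1 / 2 : ℝ) ^ j →
      ∫⁻ z, ‖iterDiff (⌊s⌋₊ + 1) (F k) h z‖ₑ ^ p.toReal ≤
        C₀ * ENNReal.ofReal (‖h‖ ^ (s * p.toReal)) * (ρ ^ ((e k - j) + (j - e k)) * β k)) :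
    MemBesov N p q s f := by
  have hpt : p ≠ ⊤ := (hpq.trans_le le_top).ne
  set P := p.toReal with hP
  have hP0 : 0 < P := ENNReal.toReal_pos hp.ne' hpt
  set M := ⌊s⌋₊ + 1 with hM
  set S : ℝ≥0∞ := 2 * ∑' i : ℕ, ρ ^ i with hS
  have hSt : S < ⊤ := by
    rw [hS, ENNReal.tsum_geometric]
    refine ENNReal.mul_lt_top (by simp) (ENNReal.inv_lt_top.2 (tsub_pos_of_lt hρ))
  -- a uniform bound for `β`
  obtain ⟨B, hBt, hB⟩ : ∃ B : ℝ≥0∞, B < ⊤ ∧ ∀ k, β k ≤ B := by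
    refine ⟨(∑' k, β k ^ a) ^ (1 / a), ENNReal.rpow_lt_top_of_nonneg (by positivity) hβ.ne, fun k => ?_⟩
    have := ENNReal.le_tsum (f := fun k => β k ^ a) k
    calc β k = (β k ^ a) ^ (1 / a) := by
          rw [← ENNReal.rpow_mul, mul_one_div_cancel (by linarith), ENNReal.rpow_one]
      _ ≤ _ := by gcongr
  have hFi : ∀ k h, Measurable (iterDiff M (F k) h) := by
    intro k h
    unfold iterDiff
    have := hFc k
    fun_prop
  -- the weight sums
  have hw1 : ∀ j, ∑' k, ρ ^ ((e k - j) + (j - e k)) ≤ S := by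
    intro j
    refine le_trans ?_ (tsum_weight ρ j)
    refine le_trans (ENNReal.tsum_comp_le_tsum_of_injective he (fun i => ρ ^ ((i - j) + (j - i)))) ?_
    exact ENNReal.tsum_le_tsum fun i => by rw [add_comm]
  have hw0 : ∑' k, ρ ^ (e k) ≤ S := by
    refine le_trans (le_of_eq ?_) (hw1 0)
    simp
  -- sums of pieces
  have hG : ∀ (j : ℕ) (h : Fin N → ℝ), (1 / 2 : ℝ) ^ (j + 1) < ‖h‖ → ‖h‖ ≤ (1 / 2 : ℝ) ^ j →
      ∫⁻ z, ‖iterDiff M f h z‖ₑ ^ P ≤ C₀ * ENNReal.ofReal (‖h‖ ^ (s * P)) *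
        ∑' k, ρ ^ ((e k - j) + (j - e k)) * β k := by
    intro j h hj1 hj2
    calc ∫⁻ z, ‖iterDiff M f h z‖ₑ ^ P ≤ ∫⁻ z, ∑' k, ‖iterDiff M (F k) h z‖ₑ ^ P := by
          refine lintegral_mono fun z => ?_
          obtain ⟨k, hk⟩ := hsel z h (hj2.trans (pow_le_one₀ (by norm_num) (by norm_num)))
          have : iterDiff M f h z = iterDiff M (F k) h z := by
            unfold iterDiff
            refine Finset.sum_congr rfl fun i hi => ?_
            rw [hk i (by have := Finset.mem_range.1 hi; omega)]
          simp only [this]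
          exact ENNReal.le_tsum (f := fun k => ‖iterDiff M (F k) h z‖ₑ ^ P) k
      _ = ∑' k, ∫⁻ z, ‖iterDiff M (F k) h z‖ₑ ^ P := by
          refine lintegral_tsum fun k => ?_
          have := hFi k h
          fun_prop
      _ ≤ ∑' k, C₀ * ENNReal.ofReal (‖h‖ ^ (s * P)) * (ρ ^ ((e k - j) + (j - e k)) * β k) :=
          ENNReal.tsum_le_tsum fun k => h1 k j h hj1 hj2
      _ = _ := ENNReal.tsum_mul_left
  have hL : ∫⁻ z, ‖f z‖ₑ ^ P ≤ C₀ * (S * B) := by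
    calc ∫⁻ z, ‖f z‖ₑ ^ P ≤ ∫⁻ z, ∑' k, ‖F k z‖ₑ ^ P := by
          refine lintegral_mono fun z => ?_
          obtain ⟨k, hk⟩ := hsel z 0 (by simp)
          have : f z = F k z := by simpa using hk 0 (Nat.zero_le _)
          simp only [this]
          exact ENNReal.le_tsum (f := fun k => ‖F k z‖ₑ ^ P) k
      _ = ∑' k, ∫⁻ z, ‖F k z‖ₑ ^ P := by
          refine lintegral_tsum fun k => ?_
          have := hFc k
          fun_prop
      _ ≤ ∑' k, C₀ * (ρ ^ (e k) * B) := ENNReal.tsum_le_tsum fun k => (h0 k).trans (by gcongr; exact hB k)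
      _ = C₀ * ((∑' k, ρ ^ (e k)) * B) := by rw [ENNReal.tsum_mul_left, ENNReal.tsum_mul_right]
      _ ≤ _ := by gcongr
  have hshell : ∀ h : Fin N → ℝ, h ≠ 0 → ‖h‖ ≤ 1 → ∃ j : ℕ, (1 / 2 : ℝ) ^ (j + 1) < ‖h‖ ∧ ‖h‖ ≤ (1 / 2 : ℝ) ^ j :=
    fun h hh hh1 => exists_nat_pow_near_of_lt_one (norm_pos_iff.2 hh) hh1 (by norm_num) (by norm_num)
  refine ⟨hf.aestronglyMeasurable, ?_⟩
  unfold besovNorm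
  rw [← hM]
  refine ENNReal.add_lt_top.2 ⟨?_, ?_⟩
  · rw [eLpNorm_eq_lintegral_rpow_enorm_toReal hp.ne' hpt]
    refine ENNReal.rpow_lt_top_of_nonneg (by positivity) (hL.trans_lt ?_).ne
    exact ENNReal.mul_lt_top hC (ENNReal.mul_lt_top hSt hBt)
  split_ifs with hq
  · -- `q = ∞`
    refine lt_of_le_of_lt (b := (C₀ * (S * B)) ^ (1 / P)) ?_ (ENNReal.rpow_lt_top_of_nonneg (by positivity)
      (ENNReal.mul_lt_top hC (ENNReal.mul_lt_top hSt hBt)).ne)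
    refine iSup₂_le fun h hh => ?_
    by_cases h00 : h = 0
    · subst h00
      rw [norm_zero, Real.zero_rpow (by linarith)]
      simp
    obtain ⟨j, hj1, hj2⟩ := hshell h h00 hh
    have hnp : 0 < ‖h‖ := norm_pos_iff.2 h00
    rw [eLpNorm_eq_lintegral_rpow_enorm_toReal hp.ne' hpt]
    have e1 : ENNReal.ofReal (‖h‖ ^ (-s)) = (ENNReal.ofReal (‖h‖ ^ (-(s * P)))) ^ (1 / P) := by
      rw [ENNReal.ofReal_rpow_of_nonneg (by positivity) (by positivity), ← Real.rpow_mul hnp.le]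
      congr 2
      field_simp
    rw [e1, ← ENNReal.mul_rpow_of_nonneg _ _ (by positivity)]
    refine ENNReal.rpow_le_rpow ?_ (by positivity)
    calc _ ≤ (C₀ * ENNReal.ofReal (‖h‖ ^ (s * P)) * ∑' k, ρ ^ ((e k - j) + (j - e k)) * B) *
          ENNReal.ofReal (‖h‖ ^ (-(s * P))) := by
          gcongr
          refine (hG j h hj1 hj2).trans ?_
          gcongr
          exact hB _
      _ = C₀ * ((∑' k, ρ ^ ((e k - j) + (j - e k))) * B) *
          (ENNReal.ofReal (‖h‖ ^ (s * P)) * ENNReal.ofReal (‖h‖ ^ (-(s * P)))) := by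
          rw [ENNReal.tsum_mul_right]; ring
      _ = C₀ * ((∑' k, ρ ^ ((e k - j) + (j - e k))) * B) := by
          rw [← ENNReal.ofReal_mul (by positivity), ← Real.rpow_add hnp]
          simp
      _ ≤ _ := by gcongr; exact hw1 j
  · -- `q < ∞`
    have hqa := haq hq
    have hq0 : 0 < q.toReal := by rw [hqa]; positivity
    refine ENNReal.rpow_lt_top_of_nonneg (by positivity) (ne_of_lt ?_)
    set G : (Fin N → ℝ) → ℝ≥0∞ := fun h => eLpNorm (iterDiff M f h) p volume ^ q.toReal *
            ENNReal.ofReal (‖h‖ ^ (-(N : ℝ) - s * q.toReal)) with hGdef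
    let A : ℕ → Set (Fin N → ℝ) := fun j => {h | (1 / 2 : ℝ) ^ (j + 1) < ‖h‖ ∧ ‖h‖ ≤ (1 / 2 : ℝ) ^ j}
    have hcov : {h : Fin N → ℝ | ‖h‖ ≤ 1} ⊆ {0} ∪ ⋃ j, A j := by
      intro h hh
      by_cases h00 : h = 0
      · left; exact h00
      · right
        exact Set.mem_iUnion.2 (hshell h h00 hh)
    have hA : ∀ j, ∫⁻ h in A j, G h ≤
        4 ^ N * (C₀ ^ a * (S ^ (a - 1) * ∑' k, ρ ^ ((e k - j) + (j - e k)) * β k ^ a)) := by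
      intro j
      have hpt : ∀ h ∈ A j, G h ≤ ENNReal.ofReal ((2 : ℝ) ^ ((j + 1) * N)) *
          (C₀ ^ a * (S ^ (a - 1) * ∑' k, ρ ^ ((e k - j) + (j - e k)) * β k ^ a)) := by
        rintro h ⟨hj1, hj2⟩
        have hnp : 0 < ‖h‖ := lt_trans (by positivity) hj1
        have e1 : ENNReal.ofReal (‖h‖ ^ (-(N : ℝ) - s * q.toReal)) =
            ENNReal.ofReal (‖h‖ ^ (-(N : ℝ))) * (ENNReal.ofReal (‖h‖ ^ (-(s * P)))) ^ a := by
          rw [ENNReal.ofReal_rpow_of_nonneg (by positivity) (by linarith), ← Real.rpow_mul hnp.le,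
            ← ENNReal.ofReal_mul (by positivity), ← Real.rpow_add hnp, hqa]
          congr 2
          ring
        have e2 : ENNReal.ofReal (‖h‖ ^ (-(N : ℝ))) ≤ ENNReal.ofReal ((2 : ℝ) ^ ((j + 1) * N)) := by
          refine ENNReal.ofReal_le_ofReal ?_
          rw [Real.rpow_neg hnp.le, Real.rpow_natCast, pow_mul, ← inv_pow]
          refine pow_le_pow_left₀ (by positivity) ?_ _
          rw [inv_le_comm₀ hnp (by positivity), ← inv_pow]
          simpa using hj1.le
        rw [hGdef]
        simp only
        rw [eLpNorm_eq_lintegral_rpow_enorm_toReal hp.ne' hpt, ← ENNReal.rpow_mul, e1, ← hP,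
          show 1 / P * q.toReal = a by rw [hqa]; field_simp]
        calc _ = ENNReal.ofReal (‖h‖ ^ (-(N : ℝ))) * ((∫⁻ z, ‖iterDiff M f h z‖ₑ ^ P) *
              ENNReal.ofReal (‖h‖ ^ (-(s * P)))) ^ a := by
              rw [ENNReal.mul_rpow_of_nonneg _ _ (by linarith)]; ring
          _ ≤ ENNReal.ofReal ((2 : ℝ) ^ ((j + 1) * N)) *
              (C₀ * ∑' k, ρ ^ ((e k - j) + (j - e k)) * β k) ^ a := by
              refine mul_le_mul' e2 (ENNReal.rpow_le_rpow ?_ (by linarith))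
              calc _ ≤ (C₀ * ENNReal.ofReal (‖h‖ ^ (s * P)) * ∑' k, ρ ^ ((e k - j) + (j - e k)) * β k) *
                    ENNReal.ofReal (‖h‖ ^ (-(s * P))) := by
                    gcongr
                    exact hG j h hj1 hj2
                _ = C₀ * (∑' k, ρ ^ ((e k - j) + (j - e k)) * β k) *
                    (ENNReal.ofReal (‖h‖ ^ (s * P)) * ENNReal.ofReal (‖h‖ ^ (-(s * P)))) := by ring
                _ = _ := by
                    rw [← ENNReal.ofReal_mul (by positivity), ← Real.rpow_add hnp, add_neg_cancel,
                      Real.rpow_zero, ENNReal.ofReal_one, mul_one]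
          _ ≤ _ := by
              rw [ENNReal.mul_rpow_of_nonneg _ _ (by linarith)]
              gcongr
              refine (holder_tsum _ _ a ha.le).trans ?_
              have := hw1 j
              have : 0 ≤ a - 1 := by linarith
              gcongr
      have hvol : volume (A j) ≤ ENNReal.ofReal ((2 * (1 / 2 : ℝ) ^ j) ^ N) := by
        have := Real.volume_pi_closedBall (ι := Fin N) 0 (r := (1 / 2 : ℝ) ^ j) (by positivity)
        rw [Fintype.card_fin] at this
        rw [← this]
        refine measure_mono fun h hh => ?_
        simpa using hh.2
      have hAm : MeasurableSet (A j) :=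
        (measurableSet_lt measurable_const measurable_norm).inter
          (measurableSet_le measurable_norm measurable_const)
      calc ∫⁻ h in A j, G h ≤ ∫⁻ h in A j, ENNReal.ofReal ((2 : ℝ) ^ ((j + 1) * N)) *
          (C₀ ^ a * (S ^ (a - 1) * ∑' k, ρ ^ ((e k - j) + (j - e k)) * β k ^ a)) :=
            setLIntegral_mono' hAm hpt
        _ ≤ (ENNReal.ofReal ((2 : ℝ) ^ ((j + 1) * N)) *
          (C₀ ^ a * (S ^ (a - 1) * ∑' k, ρ ^ ((e k - j) + (j - e k)) * β k ^ a))) *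
          ENNReal.ofReal ((2 * (1 / 2 : ℝ) ^ j) ^ N) := by
            rw [setLIntegral_const]
            gcongr
        _ = (ENNReal.ofReal ((2 : ℝ) ^ ((j + 1) * N)) * ENNReal.ofReal ((2 * (1 / 2 : ℝ) ^ j) ^ N)) *
          (C₀ ^ a * (S ^ (a - 1) * ∑' k, ρ ^ ((e k - j) + (j - e k)) * β k ^ a)) := by ring
        _ = _ := by
            congr 1
            rw [← ENNReal.ofReal_mul (by positivity), pow_mul, ← mul_pow,
              show (2 : ℝ) ^ (j + 1) * (2 * (1 / 2) ^ j) = 4 by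
                rw [pow_succ, one_div, inv_pow]; field_simp; norm_num,
              ENNReal.ofReal_pow (by norm_num)]
            simp
    calc ∫⁻ h in {h : Fin N → ℝ | ‖h‖ ≤ 1}, G h ≤ ∫⁻ h in {0} ∪ ⋃ j, A j, G h :=
          lintegral_mono_set hcov
      _ ≤ (∫⁻ h in {0}, G h) + ∫⁻ h in ⋃ j, A j, G h := lintegral_union_le _ _ _
      _ ≤ 0 + ∑' j, ∫⁻ h in A j, G h := by
          refine add_le_add (le_of_eq ?_) (lintegral_iUnion_le _ _)
          refine setLIntegral_measure_zero _ _ ?_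
          have : Nonempty (Fin N) := ⟨⟨0, hN⟩⟩
          exact measure_singleton _
      _ ≤ ∑' j : ℕ, 4 ^ N * (C₀ ^ a * (S ^ (a - 1) * ∑' k, ρ ^ ((e k - j) + (j - e k)) * β k ^ a)) := by
          rw [zero_add]
          exact ENNReal.tsum_le_tsum hA
      _ = 4 ^ N * (C₀ ^ a * (S ^ (a - 1) * ∑' k, (∑' j : ℕ, ρ ^ ((e k - j) + (j - e k))) * β k ^ a)) := by
          rw [ENNReal.tsum_mul_left, ENNReal.tsum_mul_left, ENNReal.tsum_mul_left, ENNReal.tsum_comm]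
          simp_rw [ENNReal.tsum_mul_right]
      _ ≤ 4 ^ N * (C₀ ^ a * (S ^ (a - 1) * (S * ∑' k, β k ^ a))) := by
          have : ∑' k, (∑' j : ℕ, ρ ^ ((e k - j) + (j - e k))) * β k ^ a ≤ S * ∑' k, β k ^ a := by
            rw [← ENNReal.tsum_mul_left]
            exact ENNReal.tsum_le_tsum fun k => mul_le_mul' (tsum_weight ρ _) le_rfl
          gcongr
      _ < ⊤ := by
          have h1 : C₀ ^ a < ⊤ := ENNReal.rpow_lt_top_of_nonneg (by linarith) hC.ne
          have h2 : S ^ (a - 1) < ⊤ := ENNReal.rpow_lt_top_of_nonneg (by linarith) hSt.ne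
          exact ENNReal.mul_lt_top (by simp) (ENNReal.mul_lt_top h1 (ENNReal.mul_lt_top h2
            (ENNReal.mul_lt_top hSt hβ)))


/-- Anisotropic scales: `ε` in the first `d` coordinates, `l` in the others. -/
noncomputable def tau {N : ℕ} (d : ℕ) (ε l : ℝ) (i : Fin N) : ℝ := if (i : ℕ) < d then ε else l

/-- A rescaled bump. -/
noncomputable def piece {N : ℕ} (Φ : (Fin N → ℝ) → ℝ) (d : ℕ) (A ε l : ℝ) (z0 : Fin N → ℝ) :
    (Fin N → ℝ) → ℝ :=
  fun z => A * Φ (fun i => (z i - z0 i) / tau d ε l i)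

lemma tau_pos {N d : ℕ} {ε l : ℝ} (hε : 0 < ε) (hl : 0 < l) (i : Fin N) : 0 < tau d ε l i := by
  unfold tau; split_ifs <;> assumption

lemma le_tau {N d : ℕ} {ε l : ℝ} (hl : ε ≤ l) (i : Fin N) : ε ≤ tau d ε l i := by
  unfold tau; split_ifs <;> simp [hl]

lemma prod_tau {N d : ℕ} (hd : d ≤ N) (ε l : ℝ) :
    ∏ i : Fin N, (4 * tau d ε l i) = 4 ^ N * (ε ^ d * l ^ (N - d)) := by
  obtain ⟨n, rfl⟩ := Nat.exists_eq_add_of_le hd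
  rw [Finset.prod_mul_distrib, Fin.prod_univ_add (fun i => tau d ε l i)]
  simp [tau]

lemma piece_iterDiff {N : ℕ} (Φ : (Fin N → ℝ) → ℝ) (d : ℕ) (A ε l : ℝ) (z0 : Fin N → ℝ)
    (M : ℕ) (h z : Fin N → ℝ) :
    iterDiff M (piece Φ d A ε l z0) h z =
      A * iterDiff M Φ (fun i => h i / tau d ε l i) (fun i => (z i - z0 i) / tau d ε l i) := by
  unfold iterDiff piece
  rw [Finset.mul_sum]
  refine Finset.sum_congr rfl fun j _ => ?_
  have : (fun i => ((z + (j : ℝ) • h) i - z0 i) / tau d ε l i) =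
      (fun i => (z i - z0 i) / tau d ε l i) + (j : ℝ) • fun i => h i / tau d ε l i := by
    ext i
    simp only [Pi.add_apply, Pi.smul_apply, smul_eq_mul]
    ring
  rw [this]
  ring

lemma piece_lint {N : ℕ} (Φ : (Fin N → ℝ) → ℝ) (d : ℕ) (hd : d ≤ N) (A ε l : ℝ) (z0 : Fin N → ℝ)
    (M : ℕ) (hε : 0 < ε) (hl : ε ≤ l) (hA : 0 ≤ A) (P C : ℝ) (hP : 0 < P) (hC : 0 < C)
    (hΦ0 : ∀ z, 2 ≤ ‖z‖ → Φ z = 0)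
    (hΦ : ∀ h z, |iterDiff M Φ h z| ≤ C * min 1 (‖h‖ ^ M)) (h : Fin N → ℝ) :
    ∫⁻ z, ‖iterDiff M (piece Φ d A ε l z0) h z‖ₑ ^ P ≤
      ENNReal.ofReal (((M : ℝ) + 1) * 4 ^ N *
        ((A * (C * min 1 ((‖h‖ / ε) ^ M))) ^ P * (ε ^ d * l ^ (N - d)))) := by
  have hl0 : 0 < l := hε.trans_le hl
  set B : ℝ := A * (C * min 1 ((‖h‖ / ε) ^ M)) with hB
  have hB0 : 0 ≤ B := by positivity
  have hbd : ∀ z, |iterDiff M (piece Φ d A ε l z0) h z| ≤ B := by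
    intro z
    rw [piece_iterDiff, abs_mul, abs_of_nonneg hA, hB]
    refine mul_le_mul_of_nonneg_left ((hΦ _ _).trans ?_) hA
    gcongr
    rw [pi_norm_le_iff_of_nonneg (by positivity)]
    intro i
    rw [norm_div, Real.norm_of_nonneg (tau_pos hε hl0 i).le]
    have h2 := le_tau (d := d) hl i
    have h3 := norm_le_pi_norm h i
    gcongr
  let box : ℕ → Set (Fin N → ℝ) := fun j =>
    Set.Icc (fun i => z0 i - j * h i - 2 * tau d ε l i) (fun i => z0 i - j * h i + 2 * tau d ε l i)
  let U : Set (Fin N → ℝ) := ⋃ j ∈ Finset.range (M + 1), box j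
  have hvol : volume U ≤ ENNReal.ofReal (((M : ℝ) + 1) * (4 ^ N * (ε ^ d * l ^ (N - d)))) := by
    refine (measure_biUnion_finset_le _ _).trans ?_
    have : ∀ j ∈ Finset.range (M + 1), volume (box j) ≤ ENNReal.ofReal (4 ^ N * (ε ^ d * l ^ (N - d))) := by
      intro j _
      rw [Real.volume_Icc_pi, ← prod_tau hd,
        ENNReal.ofReal_prod_of_nonneg (fun i _ => by have := tau_pos (d := d) hε hl0 i; positivity)]
      refine le_of_eq (Finset.prod_congr rfl fun i _ => ?_)
      congr 1
      ring
    refine (Finset.sum_le_sum this).trans ?_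
    rw [Finset.sum_const, Finset.card_range, nsmul_eq_mul,
      ENNReal.ofReal_mul (p := (M : ℝ) + 1) (by positivity)]
    refine le_of_eq ?_
    congr 1
    rw [← ENNReal.ofReal_natCast]
    push_cast
    rfl
  have hUm : MeasurableSet U := by
    refine Finset.measurableSet_biUnion _ fun j _ => measurableSet_Icc
  have hpt : ∀ z, ‖iterDiff M (piece Φ d A ε l z0) h z‖ₑ ^ P ≤
      U.indicator (fun _ => ENNReal.ofReal (B ^ P)) z := by
    intro z
    by_cases hz : z ∈ U
    · rw [Set.indicator_of_mem hz, ← ENNReal.ofReal_rpow_of_nonneg hB0 hP.le]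
      refine ENNReal.rpow_le_rpow ?_ hP.le
      rw [Real.enorm_eq_ofReal_abs]
      exact ENNReal.ofReal_le_ofReal (hbd z)
    · have : iterDiff M (piece Φ d A ε l z0) h z = 0 := by
        unfold iterDiff
        refine Finset.sum_eq_zero fun j hj => ?_
        have : piece Φ d A ε l z0 (z + (j : ℝ) • h) = 0 := by
          unfold piece
          rw [hΦ0 _ ?_, mul_zero]
          by_contra hlt
          rw [not_le] at hlt
          refine hz (Set.mem_biUnion (Finset.mem_coe.2 hj) ?_)
          have h4 : ∀ i, |z i + j * h i - z0 i| < 2 * tau d ε l i := by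
            intro i
            have := (norm_le_pi_norm _ i).trans_lt hlt
            rw [norm_div, Real.norm_of_nonneg (tau_pos hε hl0 i).le, div_lt_iff₀ (tau_pos hε hl0 i)] at this
            simpa using this
          constructor <;> intro i <;> have := abs_lt.1 (h4 i) <;> simp only <;> linarith
        rw [this, mul_zero]
      rw [this]
      simp [hP]
  calc _ ≤ ∫⁻ z, U.indicator (fun _ => ENNReal.ofReal (B ^ P)) z := lintegral_mono hpt
    _ = ENNReal.ofReal (B ^ P) * volume U := by rw [lintegral_indicator_const hUm]
    _ ≤ ENNReal.ofReal (B ^ P) * ENNReal.ofReal (((M : ℝ) + 1) * (4 ^ N * (ε ^ d * l ^ (N - d)))) := by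
        gcongr
    _ = _ := by
        rw [← ENNReal.ofReal_mul (by positivity)]
        congr 1
        ring

lemma scalar1 (M : ℕ) (s P θ u : ℝ) (e j : ℕ) (hP : 0 < P) (hs : 0 < s)
    (hθ : 0 < θ) (h1 : θ ≤ s * P) (h2 : θ ≤ (M - s) * P)
    (hj1 : (1 / 2 : ℝ) ^ (j + 1) < u) (hj2 : u ≤ (1 / 2 : ℝ) ^ j) :
    (min 1 ((u / (1 / 2 : ℝ) ^ e) ^ M)) ^ P * ((1 / 2 : ℝ) ^ e) ^ (s * P) ≤
      2 ^ (s * P) * u ^ (s * P) * ((1 / 2 : ℝ) ^ θ) ^ ((e - j) + (j - e)) := by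
  have hu : 0 < u := lt_trans (by positivity) hj1
  set ε : ℝ := (1 / 2 : ℝ) ^ e with hε
  have hε0 : 0 < ε := by positivity
  have hsP : 0 < s * P := by positivity
  have key : ∀ (m : ℕ) (γ : ℝ), θ ≤ γ → ((1 / 2 : ℝ) ^ m) ^ γ ≤ ((1 / 2 : ℝ) ^ θ) ^ m := by
    intro m γ hγ
    rw [← Real.rpow_natCast, ← Real.rpow_natCast, ← Real.rpow_mul (by norm_num),
      ← Real.rpow_mul (by norm_num)]
    refine Real.rpow_le_rpow_of_exponent_ge (by norm_num) (by norm_num) ?_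
    rw [mul_comm]
    gcongr
  rcases le_total e j with hej | hej
  · have hr : u / ε ≤ (1 / 2 : ℝ) ^ (j - e) := by
      rw [div_le_iff₀ hε0, hε, ← pow_add, Nat.sub_add_cancel hej]
      exact hj2
    have hr0 : 0 < u / ε := by positivity
    have hMs : 0 ≤ (M - s) * P := hθ.le.trans h2
    have hkey := key (j - e) ((M - s) * P) h2
    calc _ ≤ ((u / ε) ^ M) ^ P * ε ^ (s * P) := by
          gcongr
          exact min_le_right _ _
      _ = u ^ (s * P) * (u / ε) ^ ((M - s) * P) := by
          rw [← Real.rpow_natCast, ← Real.rpow_mul hr0.le, sub_mul, Real.rpow_sub hr0,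
            Real.div_rpow hu.le hε0.le (s * P)]
          have := Real.rpow_pos_of_pos hε0 (s * P)
          have := Real.rpow_pos_of_pos hu (s * P)
          field_simp
      _ ≤ 1 * u ^ (s * P) * ((1 / 2 : ℝ) ^ θ) ^ ((e - j) + (j - e)) := by
          rw [one_mul, Nat.sub_eq_zero_of_le hej, zero_add]
          gcongr
          refine le_trans ?_ hkey
          gcongr
      _ ≤ _ := by
          gcongr
          exact Real.one_le_rpow (by norm_num) hsP.le
  · have hr : ε / u ≤ 2 * (1 / 2 : ℝ) ^ (e - j) := by
      rw [div_le_iff₀ hu]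
      have : ε = 2 * (1 / 2 : ℝ) ^ (e - j) * (1 / 2) ^ (j + 1) := by
        rw [hε, pow_succ]
        conv_lhs => rw [← Nat.sub_add_cancel hej, pow_add]
        ring
      rw [this]
      gcongr
    calc _ ≤ 1 ^ P * ε ^ (s * P) := by
          gcongr
          exact min_le_left _ _
      _ = u ^ (s * P) * (ε / u) ^ (s * P) := by
          rw [← Real.mul_rpow (by positivity) (by positivity), Real.one_rpow, one_mul]
          congr 1
          field_simp
      _ ≤ u ^ (s * P) * (2 * (1 / 2 : ℝ) ^ (e - j)) ^ (s * P) := by gcongr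
      _ = 2 ^ (s * P) * u ^ (s * P) * ((1 / 2 : ℝ) ^ (e - j)) ^ (s * P) := by
          rw [Real.mul_rpow (by positivity) (by positivity)]; ring
      _ ≤ _ := by
          rw [Nat.sub_eq_zero_of_le hej, add_zero]
          gcongr
          exact key _ _ h1

lemma scalar2 (P s c ε : ℝ) (d : ℕ) (hP : 0 < P) (hc : 0 < c) (hε : 0 < ε) :
    (c * ε ^ (-(d / P - s))) ^ P * ε ^ d = c ^ P * ε ^ (s * P) := by
  rw [Real.mul_rpow hc.le (by positivity), ← Real.rpow_mul hε.le, mul_assoc, ← Real.rpow_natCast,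
    ← Real.rpow_add hε]
  congr 2
  field_simp
  ring

lemma piece_ne_zero {N : ℕ} (Φ : (Fin N → ℝ) → ℝ) (d : ℕ) (A ε l : ℝ) (z0 : Fin N → ℝ)
    (hε : 0 < ε) (hε1 : ε ≤ 1) (hΦ0 : ∀ z, 2 ≤ ‖z‖ → Φ z = 0) (w : Fin N → ℝ)
    (hw : piece Φ d A ε l z0 w ≠ 0) (i : Fin N) (hi : (i : ℕ) < d) : |w i - z0 i| < 2 := by
  by_contra hge
  rw [not_lt] at hge
  refine hw ?_
  unfold piece
  rw [hΦ0 _ ?_, mul_zero]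
  refine le_trans ?_ (norm_le_pi_norm _ i)
  simp only [tau, hi, if_true]
  rw [norm_div, Real.norm_of_nonneg hε.le, le_div_iff₀ hε, Real.norm_eq_abs]
  linarith


end BesovAux

open BesovAux in
/-- Theorem 1.4 in the subcritical case `sp < d`: for `0 < p < q ≤ ∞`, `s > σ_p` with
`s p < d` and `r = dp/(d - sp)`, there exists `f ∈ B^s_{p,q}(ℝ^N)` such that
`f(·,y) ∉ L^{r,∞}(ℝ^d)` for a.e. `y ∈ ℝ^{N-d}`. -/
theorem besov_restriction_not_weakLp (N d : ℕ) (hN : 2 ≤ N) (hd : 1 ≤ d) (hdN : d < N)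
    (p q : ℝ≥0∞) (hp : 0 < p) (hpq : p < q)
    (s : ℝ) (hs : sigmaP N p < s) (hsp : s * p.toReal < d)
    (r : ℝ) (hr : r = d * p.toReal / (d - s * p.toReal)) :
    ∃ f : (Fin N → ℝ) → ℝ, MemBesov N p q s f ∧
      ∀ᵐ y ∂(MeasureTheory.volume : Measure (Fin (N - d) → ℝ)),
        ¬ MemWeakLp r (restrictLast N d f y) := by
  have hpt : p ≠ ⊤ := (hpq.trans_le le_top).ne
  have hs0 : 0 < s := lt_of_le_of_lt (by unfold sigmaP; positivity) hs
  set P := p.toReal with hPdef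
  have hP : 0 < P := ENNReal.toReal_pos hp.ne' hpt
  obtain ⟨a, ha, haq⟩ : ∃ a : ℝ, 1 < a ∧ (q ≠ ⊤ → q.toReal = a * P) := by
    by_cases hq : q = ⊤
    · exact ⟨2, by norm_num, fun h => absurd hq h⟩
    · refine ⟨q.toReal / P, ?_, fun _ => by field_simp⟩
      rw [one_lt_div hP]
      exact (ENNReal.toReal_lt_toReal hpt hq).2 hpq
  obtain ⟨K, hK, c, L, y, hc, hL, hsum, hcov⟩ := exists_cover (N - d) (by omega) P a ha
  set M := ⌊s⌋₊ + 1 with hM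
  have hMs : s < M := by rw [hM]; push_cast; exact Nat.lt_floor_add_one s
  obtain ⟨Φ, C, hC, hΦc, hΦn, hΦ1, hΦ0, hΦb, hΦd⟩ := exists_bump N M
  obtain ⟨⟨enc, henc⟩⟩ := nonempty_embedding_nat K
  let e : K → ℕ := fun k => Nat.pair (enc k) (L k)
  have he : Function.Injective e := fun k k' h => henc (Nat.pair_eq_pair.1 h).1
  let ε : K → ℝ := fun k => (1 / 2 : ℝ) ^ (e k)
  let l : K → ℝ := fun k => 1 / (L k : ℝ)
  have hε : ∀ k, 0 < ε k := fun k => by positivity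
  have hε1 : ∀ k, ε k ≤ 1 := fun k => pow_le_one₀ (by norm_num) (by norm_num)
  have hεl : ∀ k, ε k ≤ l k := by
    intro k
    have h1 : ((L k : ℕ) : ℝ) ≤ 2 ^ (e k) := by
      have h2 : L k ≤ e k := Nat.right_le_pair _ _
      have h3 : e k < 2 ^ (e k) := Nat.lt_two_pow_self
      exact_mod_cast h2.trans h3.le
    have h4 : (0 : ℝ) < L k := by exact_mod_cast hL k
    simp only [ε, l]
    rw [one_div_pow]
    exact one_div_le_one_div_of_le h4 h1
  have hl : ∀ k, 0 < l k := fun k => (hε k).trans_le (hεl k)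
  let D : ℝ := 2 * M + 4
  let z0 : K → Fin N → ℝ := fun k i =>
    if h : (i : ℕ) < d then D * e k else y k ⟨(i : ℕ) - d, by have := i.isLt; omega⟩
  let A : K → ℝ := fun k => c k * ε k ^ (-(d / P - s))
  have hA : ∀ k, 0 < A k := fun k => mul_pos (hc k) (Real.rpow_pos_of_pos (hε k) _)
  let F : K → (Fin N → ℝ) → ℝ := fun k => piece Φ d (A k) (ε k) (l k) (z0 k)
  have hFn : ∀ k z, 0 ≤ F k z := fun k z => mul_nonneg (hA k).le (hΦn _)
  have hFm : ∀ k, Measurable (F k) := by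
    intro k
    have : Continuous (F k) := by
      simp only [F]
      unfold piece
      fun_prop
    exact this.measurable
  let f : (Fin N → ℝ) → ℝ := fun z => (∑' k, ENNReal.ofReal (F k z)).toReal
  have hfm : Measurable f := by
    refine Measurable.ennreal_toReal (Measurable.tsum fun k => ?_)
    exact (hFm k).ennreal_ofReal
  have hfs : ∀ z k, (∀ k', k' ≠ k → F k' z = 0) → f z = F k z := by
    intro z k hk
    simp only [f]
    rw [tsum_eq_single k (fun k' hk' => by rw [hk k' hk', ENNReal.ofReal_zero]),
      ENNReal.toReal_ofReal (hFn k z)]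
  -- separation
  let i0 : Fin N := ⟨0, by omega⟩
  have hFne : ∀ k w, F k w ≠ 0 → |w i0 - D * e k| < 2 := by
    intro k w hw
    have := piece_ne_zero Φ d (A k) (ε k) (l k) (z0 k) (hε k) (hε1 k) hΦ0 w hw i0
      (show 0 < d by omega)
    have h0 : z0 k i0 = D * e k := by
      simp only [z0, i0]
      rw [dif_pos (by omega)]
    rwa [h0] at this
  have hsep : ∀ (z h : Fin N → ℝ), ‖h‖ ≤ 1 → ∀ k k' (i i' : ℕ), i ≤ M → i' ≤ M →
      F k (z + (i : ℝ) • h) ≠ 0 → F k' (z + (i' : ℝ) • h) ≠ 0 → k = k' := by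
    intro z h hh k k' i i' hi hi' h1 h2
    by_contra hne
    have hee : e k ≠ e k' := fun h => hne (he h)
    have b : ∀ (k : K) (i : ℕ), i ≤ M → F k (z + (i : ℝ) • h) ≠ 0 → |z i0 - D * e k| < M + 2 := by
      intro k i hi hF
      have h3 := hFne k _ hF
      have h4 : |(i : ℝ) * h i0| ≤ M := by
        rw [abs_mul, Nat.abs_cast]
        have h5 : |h i0| ≤ 1 := (norm_le_pi_norm h i0).trans hh
        have h6 : (i : ℝ) ≤ M := by exact_mod_cast hi
        calc (i : ℝ) * |h i0| ≤ i * 1 := by gcongr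
          _ ≤ M := by linarith
      simp only [Pi.add_apply, Pi.smul_apply, smul_eq_mul] at h3
      rw [abs_lt] at h3 ⊢
      rw [abs_le] at h4
      constructor <;> linarith
    have b1 := abs_lt.1 (b k i hi h1)
    have b2 := abs_lt.1 (b k' i' hi' h2)
    have hD : 0 < D := by positivity
    have hDM : D = 2 * M + 4 := rfl
    rcases lt_or_gt_of_ne hee with hlt | hlt
    · have : (e k : ℝ) + 1 ≤ e k' := by exact_mod_cast hlt
      have := mul_le_mul_of_nonneg_left this hD.le
      linarith
    · have : (e k' : ℝ) + 1 ≤ e k := by exact_mod_cast hlt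
      have := mul_le_mul_of_nonneg_left this hD.le
      linarith
  have hself : ∀ z k, F k z ≠ 0 → f z = F k z := by
    intro z k hk
    refine hfs z k fun k' hk' => ?_
    by_contra h0
    exact hk' (hsep z 0 (by simp) k' k 0 0 (by omega) (by omega) (by simpa using h0)
      (by simpa using hk))
  obtain ⟨k0, -⟩ := hcov 0 0
  have hsel : ∀ z h : Fin N → ℝ, ‖h‖ ≤ 1 → ∃ k, ∀ i : ℕ, i ≤ M →
      f (z + (i : ℝ) • h) = F k (z + (i : ℝ) • h) := by
    intro z h hh
    by_cases hex : ∃ k, ∃ i : ℕ, i ≤ M ∧ F k (z + (i : ℝ) • h) ≠ 0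
    · obtain ⟨k, i, hi, hne⟩ := hex
      refine ⟨k, fun i' hi' => hfs _ k fun k' hk' => ?_⟩
      by_contra h0
      exact hk' (hsep z h hh k' k i' i hi' hi h0 hne)
    · push Not at hex
      exact ⟨k0, fun i hi => hfs _ k0 fun k' _ => hex k' i hi⟩
  -- the estimates
  set θ : ℝ := min (s * P) ((M - s) * P) with hθ
  have hθ0 : 0 < θ := lt_min (by positivity) (mul_pos (by linarith) hP)
  have hθ1 : θ ≤ s * P := min_le_left _ _
  have hθ2 : θ ≤ (M - s) * P := min_le_right _ _
  set R : ℝ := (1 / 2 : ℝ) ^ θ with hR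
  have hR0 : 0 < R := by positivity
  have hR1 : R < 1 := Real.rpow_lt_one (by norm_num) (by norm_num) hθ0
  set Q : ℝ := ((M : ℝ) + 1) * 4 ^ N * (C ^ P * 2 ^ (s * P)) with hQ
  have hQ0 : 0 < Q := by positivity
  let b : K → ℝ := fun k => c k ^ P * (1 / (L k : ℝ)) ^ (N - d)
  have hb0 : ∀ k, 0 ≤ b k := fun k => by
    have := hc k
    positivity
  have hsplit : ∀ k (m : ℝ), 0 ≤ m → (A k * (C * m)) ^ P * (ε k ^ d * l k ^ (N - d)) =
      C ^ P * b k * (m ^ P * ε k ^ (s * P)) := by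
    intro k m hm
    have h1 := scalar2 P s (c k) (ε k) d hP (hc k) (hε k)
    rw [Real.mul_rpow (hA k).le (by positivity), Real.mul_rpow hC.le hm]
    calc _ = (A k ^ P * ε k ^ d) * (C ^ P * m ^ P * l k ^ (N - d)) := by ring
      _ = (c k ^ P * ε k ^ (s * P)) * (C ^ P * m ^ P * l k ^ (N - d)) := by rw [← h1]
      _ = _ := by simp only [b, l]; ring
  refine ⟨f, ?_, ?_⟩
  · refine memBesov_of_pieces N (by omega) p q hp hpq s hs0 a ha haq F hFm f hfm hsel e he
      (fun k => ENNReal.ofReal (b k)) hsum (ENNReal.ofReal Q) (ENNReal.ofReal R)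
      ENNReal.ofReal_lt_top (by rw [← ENNReal.ofReal_one]; exact (ENNReal.ofReal_lt_ofReal_iff one_pos).2 hR1)
      ?_ ?_
    · intro k
      have h1 := piece_lint Φ d hdN.le (A k) (ε k) (l k) (z0 k) 0 (hε k) (hεl k) (hA k).le P C hP hC hΦ0
        (fun h z => by simpa [iterDiff] using hΦb z) 0
      have h2 : ∀ z, iterDiff 0 (piece Φ d (A k) (ε k) (l k) (z0 k)) 0 z = F k z := by
        intro z; simp [iterDiff, F]
      simp only [h2] at h1
      refine h1.trans ?_
      rw [← ENNReal.ofReal_pow hR0.le, ← ENNReal.ofReal_mul (by positivity),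
        ← ENNReal.ofReal_mul (by positivity)]
      refine ENNReal.ofReal_le_ofReal ?_
      rw [pow_zero, min_self, hsplit k 1 zero_le_one, Real.one_rpow, one_mul]
      have h3 : ε k ^ (s * P) ≤ R ^ (e k) := by
        simp only [ε, hR]
        rw [← Real.rpow_natCast, ← Real.rpow_natCast, ← Real.rpow_mul (by norm_num),
          ← Real.rpow_mul (by norm_num)]
        refine Real.rpow_le_rpow_of_exponent_ge (by norm_num) (by norm_num) ?_
        rw [mul_comm]
        gcongr
      have h4 : (1 : ℝ) ≤ 2 ^ (s * P) := Real.one_le_rpow (by norm_num) (by positivity)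
      have h5 : ((0 : ℕ) : ℝ) + 1 ≤ (M : ℝ) + 1 := by simp
      calc (((0 : ℕ) : ℝ) + 1) * 4 ^ N * (C ^ P * b k * ε k ^ (s * P))
          ≤ ((M : ℝ) + 1) * 4 ^ N * (C ^ P * b k * R ^ (e k)) := by
            have := hb0 k
            gcongr
        _ = ((M : ℝ) + 1) * 4 ^ N * (C ^ P * 1) * (R ^ (e k) * b k) := by ring
        _ ≤ _ := by
            have := hb0 k
            rw [hQ]
            gcongr
    · intro k j h hj1 hj2
      refine (piece_lint Φ d hdN.le (A k) (ε k) (l k) (z0 k) M (hε k) (hεl k) (hA k).le P C hP hC hΦ0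
        hΦd h).trans ?_
      rw [← ENNReal.ofReal_pow hR0.le, ← ENNReal.ofReal_mul (by positivity),
        ← ENNReal.ofReal_mul (by positivity), ← ENNReal.ofReal_mul (by positivity)]
      refine ENNReal.ofReal_le_ofReal ?_
      have hm : 0 ≤ min 1 ((‖h‖ / ε k) ^ M) := le_min zero_le_one (by have := hε k; positivity)
      rw [hsplit k _ hm]
      have h1 := scalar1 M s P θ ‖h‖ (e k) j hP hs0 hθ0 hθ1 hθ2 hj1 hj2
      calc _ ≤ ((M : ℝ) + 1) * 4 ^ N * (C ^ P * b k * (2 ^ (s * P) * ‖h‖ ^ (s * P) *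
              R ^ ((e k - j) + (j - e k)))) := by
            have := hb0 k
            gcongr
        _ = _ := by rw [hQ]; ring
  · refine Filter.Eventually.of_forall fun v hv => ?_
    obtain ⟨-, W, hW⟩ := hv
    obtain ⟨k, hk1, hk2⟩ := hcov v (2 * W)
    have hAk := hA k
    have hεk := hε k
    have hck := hc k
    have hd0 : (0 : ℝ) < d := by exact_mod_cast hd
    have hr1 : 1 / r = (d - s * P) / (d * P) := by rw [hr, one_div_div]
    have hr0 : 0 < 1 / r := by rw [hr1]; exact div_pos (by linarith) (by positivity)
    have hsub : Metric.closedBall (fun _ : Fin d => D * (e k : ℝ)) (ε k) ⊆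
        {x | A k / 2 < |restrictLast N d f v x|} := by
      intro x hx
      rw [mem_closedBall_iff_norm] at hx
      have hFk : restrictLast N d (F k) v x = A k := by
        simp only [restrictLast, F, piece]
        rw [hΦ1 _ ?_, mul_one]
        rw [pi_norm_le_iff_of_nonneg zero_le_one]
        intro i
        rw [norm_div, Real.norm_of_nonneg (tau_pos (hε k) (hl k) i).le, div_le_one (tau_pos (hε k) (hl k) i)]
        simp only [z0, tau]
        split_ifs with hi
        · exact (norm_le_pi_norm _ (⟨i, hi⟩ : Fin d)).trans hx
        · exact (norm_le_pi_norm (v - y k) _).trans hk2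
      have hfk : restrictLast N d f v x = A k := by
        rw [← hFk]
        refine hself _ k ?_
        change restrictLast N d (F k) v x ≠ 0
        rw [hFk]
        exact hAk.ne'
      simp only [Set.mem_ofPred_eq]
      rw [hfk, abs_of_pos hAk]
      linarith
    have hvol : ENNReal.ofReal ((2 * ε k) ^ d) ≤ volume {x | A k / 2 < |restrictLast N d f v x|} := by
      have := Real.volume_pi_closedBall (fun _ : Fin d => D * (e k : ℝ)) (hε k).le
      rw [Fintype.card_fin] at this
      rw [← this]
      exact measure_mono hsub
    have h1 := hW (A k / 2) (by positivity)
    have h2 : ENNReal.ofReal (A k / 2 * ((2 * ε k) ^ d) ^ (1 / r)) ≤ ENNReal.ofReal W := by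
      refine le_trans ?_ h1
      rw [ENNReal.ofReal_mul (by positivity), ← ENNReal.ofReal_rpow_of_nonneg (by positivity) hr0.le]
      gcongr
    have h3 : c k / 2 ≤ A k / 2 * ((2 * ε k) ^ d) ^ (1 / r) := by
      have h4 : (ε k ^ d) ^ (1 / r) = ε k ^ (d / P - s) := by
        rw [← Real.rpow_natCast, ← Real.rpow_mul hεk.le, hr1]
        congr 1
        field_simp
      calc c k / 2 = A k / 2 * (ε k ^ d) ^ (1 / r) := by
            rw [h4]
            simp only [A]
            have : ε k ^ (-(d / P - s)) * ε k ^ (d / P - s) = 1 := by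
              rw [← Real.rpow_add hεk, neg_add_cancel, Real.rpow_zero]
            linear_combination (-(c k / 2)) * this
        _ ≤ _ := by
            gcongr
            linarith
    have h5 : ENNReal.ofReal (c k / 2) ≤ ENNReal.ofReal W := (ENNReal.ofReal_le_ofReal h3).trans h2
    have h6 : ENNReal.ofReal W < ENNReal.ofReal (c k / 2) :=
      (ENNReal.ofReal_lt_ofReal_iff (by positivity)).2 (by linarith)
    exact absurd h5 (not_le.2 h6)
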